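/- Let 1 < α < 2, β₁ = 1/(α−1) and 1 < β₂ < 1/(α−1), and let (m_n) be a sequence of positive integers such that m_n^{−β₂}/n^{−β₁} → c for some c ∈ (0,∞) as n → ∞. Then lim_{n→∞} ρ(n,−m_n)/(n^{−β₁} m_n^{−β₂(α−1)}) = c · Σ_{i=0}^∞ Σ_{j=0}^∞ V(w_{(∞,j)} c^{−1} (1+j)^{−β₂}, w_{(i,∞)} (1+i)^{−β₁}). -/

import Mathlib

open Filter MeasureTheory Real Set

/-- The kernel `V(x,y) = xy/(x^2+y^2)^{(2-α)/2}` with `V(0,0)=0`. -/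
noncomputable def V (α : ℝ) : ℝ → ℝ → ℝ := fun x y =>
  if x = 0 ∧ y = 0 then 0 else x * y / (x ^ 2 + y ^ 2) ^ ((2 - α) / 2)

lemma V_bound (α s x y : ℝ) (hs1 : α - 1 ≤ s) (hs2 : s ≤ 1) :
    |V α x y| ≤ |x| ^ s * |y| ^ (α - s) := by
  have hR : 0 ≤ |x| ^ s * |y| ^ (α - s) := by positivity
  by_cases hx : x = 0
  · have : V α x y = 0 := by simp [V, hx]
    rw [this]; simpa using hR
  by_cases hy : y = 0
  · have : V α x y = 0 := by simp [V, hy]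
    rw [this]; simpa using hR
  have hx' : 0 < |x| := abs_pos.mpr hx
  have hy' : 0 < |y| := abs_pos.mpr hy
  have hQ : 0 < x ^ 2 + y ^ 2 := by positivity
  have e1 : |x| ≤ (x ^ 2 + y ^ 2) ^ (1 / 2 : ℝ) := by
    rw [← Real.sqrt_eq_rpow]; exact Real.abs_le_sqrt (by nlinarith [sq_nonneg y])
  have e2 : |y| ≤ (x ^ 2 + y ^ 2) ^ (1 / 2 : ℝ) := by
    rw [← Real.sqrt_eq_rpow]; exact Real.abs_le_sqrt (by nlinarith [sq_nonneg x])
  have f1 := Real.rpow_le_rpow hx'.le e1 (show 0 ≤ 1 - s by linarith)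
  have f2 := Real.rpow_le_rpow hy'.le e2 (show 0 ≤ 1 - α + s by linarith)
  have f3 := mul_le_mul f1 f2 (by positivity) (by positivity)
  rw [← Real.rpow_mul hQ.le, ← Real.rpow_mul hQ.le, ← Real.rpow_add hQ] at f3
  have e3 : 1 / 2 * (1 - s) + 1 / 2 * (1 - α + s) = (2 - α) / 2 := by ring
  rw [e3] at f3
  have hV : V α x y = x * y / (x ^ 2 + y ^ 2) ^ ((2 - α) / 2) := by simp [V, hx]
  have hP : 0 < (x ^ 2 + y ^ 2) ^ ((2 - α) / 2) := by positivity
  rw [hV, abs_div, abs_mul, abs_of_pos hP, div_le_iff₀ hP]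
  have g1 : |x| = |x| ^ s * |x| ^ (1 - s) := by
    rw [← Real.rpow_add hx']; simp
  have g2 : |y| = |y| ^ (α - s) * |y| ^ (1 - α + s) := by
    rw [← Real.rpow_add hy']; ring_nf; simp
  calc |x| * |y| = (|x| ^ s * |y| ^ (α - s)) * (|x| ^ (1 - s) * |y| ^ (1 - α + s)) := by
        conv_lhs => rw [g1, g2]
        ring
    _ ≤ _ := mul_le_mul_of_nonneg_left f3 hR

lemma V_hom (α T x y : ℝ) (hT : 0 < T) : V α (x / T) (y / T) = V α x y / T ^ α := by
  by_cases h : x = 0 ∧ y = 0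
  · simp [V, h]
  have h' : ¬ (x / T = 0 ∧ y / T = 0) := by
    simpa [hT.ne'] using h
  have hQ : 0 ≤ x ^ 2 + y ^ 2 := by positivity
  have hQ' : 0 < x ^ 2 + y ^ 2 := by
    rcases not_and_or.mp h with h | h <;> positivity
  have hP : 0 < (x ^ 2 + y ^ 2) ^ ((2 - α) / 2) := by positivity
  simp only [V, if_neg h, if_neg h']
  have e : (x / T) ^ 2 + (y / T) ^ 2 = (x ^ 2 + y ^ 2) / T ^ 2 := by field_simp
  have e2 : (T ^ 2) ^ ((2 - α) / 2) = T ^ 2 / T ^ α := by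
    rw [← Real.rpow_natCast T 2, ← Real.rpow_mul hT.le, ← Real.rpow_sub hT]
    congr 1; push_cast; ring
  have hTα : 0 < T ^ α := by positivity
  rw [e, Real.div_rpow hQ (by positivity), e2]
  field_simp

lemma V_tendsto (α x y : ℝ) (hx : 0 < x) {f g : ℕ → ℝ}
    (hf : Tendsto f atTop (nhds x)) (hg : Tendsto g atTop (nhds y)) :
    Tendsto (fun n => V α (f n) (g n)) atTop (nhds (V α x y)) := by
  have hV : V α x y = x * y / (x ^ 2 + y ^ 2) ^ ((2 - α) / 2) := by simp [V, hx.ne']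
  rw [hV]
  have hQ : 0 < x ^ 2 + y ^ 2 := by positivity
  have h1 : Tendsto (fun n => f n * g n / ((f n) ^ 2 + (g n) ^ 2) ^ ((2 - α) / 2)) atTop
      (nhds (x * y / (x ^ 2 + y ^ 2) ^ ((2 - α) / 2))) := by
    refine (hf.mul hg).div ?_ (by positivity)
    exact ((hf.pow 2).add (hg.pow 2)).rpow_const (Or.inl hQ.ne')
  refine h1.congr' ?_
  filter_upwards [hf.eventually (lt_mem_nhds hx)] with n hn
  simp [V, hn.ne']

lemma w_bdd (w : ℕ → ℕ → ℝ)
    (hA1 : Tendsto (fun p : ℕ × ℕ => w p.1 p.2) (atTop ×ˢ atTop) (nhds 1))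
    (winf : ℕ → ℝ)
    (hA2 : ∀ i, Tendsto (fun j => w i j) atTop (nhds (winf i)))
    (wco : ℕ → ℝ)
    (hA3 : ∀ j, Tendsto (fun i => w i j) atTop (nhds (wco j))) :
    ∃ W : ℝ, 0 < W ∧ ∀ i j, |w i j| ≤ W := by
  have h1 : ∀ᶠ p : ℕ × ℕ in atTop, |w p.1 p.2| ≤ 2 := by
    rw [prod_atTop_atTop_eq] at hA1
    exact (hA1.abs.eventually (gt_mem_nhds (by norm_num : |(1 : ℝ)| < 2))).mono fun _ h => h.le
  obtain ⟨⟨N, M⟩, hNM⟩ := eventually_atTop.mp h1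
  have h2 : ∀ i, ∃ B, ∀ j, |w i j| ≤ B := fun i => by
    obtain ⟨B, hB⟩ := (hA2 i).abs.bddAbove_range
    exact ⟨B, fun j => hB ⟨j, rfl⟩⟩
  have h3 : ∀ j, ∃ B, ∀ i, |w i j| ≤ B := fun j => by
    obtain ⟨B, hB⟩ := (hA3 j).abs.bddAbove_range
    exact ⟨B, fun i => hB ⟨i, rfl⟩⟩
  choose B hB using h2
  choose D hD using h3
  have hB0 : ∀ i, 0 ≤ B i := fun i => (abs_nonneg _).trans (hB i 0)
  have hD0 : ∀ i, 0 ≤ D i := fun i => (abs_nonneg _).trans (hD i 0)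
  have sB : 0 ≤ ∑ i ∈ Finset.range N, B i := Finset.sum_nonneg fun i _ => hB0 i
  have sD : 0 ≤ ∑ i ∈ Finset.range M, D i := Finset.sum_nonneg fun i _ => hD0 i
  refine ⟨2 + ∑ i ∈ Finset.range N, B i + ∑ i ∈ Finset.range M, D i, by linarith, fun i j => ?_⟩
  by_cases hi : i < N
  · have := Finset.single_le_sum (fun i _ => hB0 i) (Finset.mem_range.mpr hi)
    linarith [hB i j]
  by_cases hj : j < M
  · have := Finset.single_le_sum (fun i _ => hD0 i) (Finset.mem_range.mpr hj)
    linarith [hD j i]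
  have := hNM (i, j) ⟨not_lt.mp hi, not_lt.mp hj⟩
  simp only at this
  linarith

lemma summable_shift (p : ℝ) (hp : 1 < p) : Summable (fun i : ℕ => (1 + (i : ℝ)) ^ (-p)) := by
  have := (summable_nat_add_iff 1).mpr (Real.summable_nat_rpow.mpr (by linarith : -p < -1))
  refine this.congr fun i => ?_
  push_cast; rw [add_comm]

/-- `((a + n)/n)^(-β)` tends to one. -/
lemma ratio_tendsto (β a : ℝ) {u : ℕ → ℝ} (hu : Tendsto u atTop atTop) :
    Tendsto (fun n => ((a + u n) / u n) ^ (-β)) atTop (nhds 1) := by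
  have h1 : Tendsto (fun n => a / u n + 1) atTop (nhds (0 + 1)) :=
    (hu.const_div_atTop a).add_const 1
  have h2 : Tendsto (fun n => (a + u n) / u n) atTop (nhds 1) := by
    rw [zero_add] at h1
    refine h1.congr' ?_
    filter_upwards [hu.eventually_gt_atTop 0] with n hn
    field_simp
  simpa using h2.rpow_const (p := -β) (Or.inl one_ne_zero)

theorem stmt18 (α β₁ β₂ : ℝ)
    (hα : 1 < α) (hα2 : α < 2)
    (hβ₁ : β₁ = 1 / (α - 1)) (hβ₂l : 1 < β₂) (hβ₂u : β₂ < 1 / (α - 1))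
    (w : ℕ → ℕ → ℝ) (hw : ∀ i j, w i j ≠ 0)
    (hA1 : Tendsto (fun p : ℕ × ℕ => w p.1 p.2) (atTop ×ˢ atTop) (nhds 1))
    (winf : ℕ → ℝ)
    (hA2 : ∀ i, Tendsto (fun j => w i j) atTop (nhds (winf i)) ∧ 0 < winf i)
    (wco : ℕ → ℝ)
    (hA3 : ∀ j, Tendsto (fun i => w i j) atTop (nhds (wco j)) ∧ 0 < wco j)
    (c : ℕ → ℕ → ℝ)
    (hc : ∀ i j, c i j = w i j * (1 + (i : ℝ)) ^ (-β₁) * (1 + (j : ℝ)) ^ (-β₂))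
    (ρ : ℕ → ℕ → ℝ)
    (hsum : ∀ n m : ℕ, 1 ≤ n → 1 ≤ m →
      Summable (fun q : ℕ × ℕ => V α (c (q.1 + n) q.2) (c q.1 (q.2 + m))))
    (hρ : ∀ n m : ℕ, 1 ≤ n → 1 ≤ m →
      ρ n m = ∑' i : ℕ, ∑' j : ℕ, V α (c (i + n) j) (c i (j + m)))
    (m : ℕ → ℕ) (hm : ∀ n, 1 ≤ m n) (C : ℝ) (hC : 0 < C)
    (hratio : Tendsto (fun n : ℕ => (m n : ℝ) ^ (-β₂) / (n : ℝ) ^ (-β₁))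
      atTop (nhds C))
    :
    Tendsto (fun n : ℕ => ρ n (m n) / ((n : ℝ) ^ (-β₁) * (m n : ℝ) ^ (-(β₂ * (α - 1)))))
      atTop
      (nhds (C * ∑' i : ℕ, ∑' j : ℕ,
        V α (wco j * C⁻¹ * (1 + (j : ℝ)) ^ (-β₂)) (winf i * (1 + (i : ℝ)) ^ (-β₁)))) := by
  obtain ⟨W, hW0, hW⟩ := w_bdd w hA1 winf (fun i => (hA2 i).1) wco (fun j => (hA3 j).1)
  have hα1 : 0 < α - 1 := by linarith
  have hβ₁0 : 0 < β₁ := by rw [hβ₁]; positivity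
  have hβ₂0 : 0 < β₂ := by linarith
  obtain ⟨s, hs1, hs2⟩ : ∃ s, 1 / β₂ < s ∧ s < 1 :=
    exists_between (by rw [div_lt_one hβ₂0]; exact hβ₂l)
  have hsα : α - 1 ≤ s := by
    have : α - 1 < 1 / β₂ := by
      rw [lt_div_iff₀ hβ₂0]; rw [lt_div_iff₀ hα1] at hβ₂u; linarith
    linarith
  have hp1 : 1 < β₂ * s := by
    rw [div_lt_iff₀ hβ₂0] at hs1; linarith
  have hp2 : 1 < β₁ * (α - s) := by
    rw [hβ₁, one_div, inv_mul_eq_div, lt_div_iff₀ hα1]; linarith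
  have hs0 : 0 < s := by linarith
  have hαs : 0 < α - s := by linarith
  -- limits of scales
  have hn : Tendsto (fun n : ℕ => (n : ℝ)) atTop atTop := tendsto_natCast_atTop_atTop
  have hT0 : ∀ n, 0 < (m n : ℝ) ^ (-β₂) := fun n =>
    Real.rpow_pos_of_pos (by exact_mod_cast hm n) _
  have hTz : Tendsto (fun n => (m n : ℝ) ^ (-β₂)) atTop (nhds 0) := by
    have h := hratio.mul ((tendsto_rpow_neg_atTop hβ₁0).comp hn)
    rw [mul_zero] at h
    refine h.congr' ?_
    filter_upwards [eventually_gt_atTop 0] with n hn0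
    have : 0 < (n : ℝ) ^ (-β₁) := Real.rpow_pos_of_pos (by exact_mod_cast hn0) _
    simp only [Function.comp]
    field_simp
  have hmN : Tendsto m atTop atTop := by
    rw [tendsto_atTop]
    intro K
    have hK : 0 < ((K : ℝ) + 1) ^ (-β₂) := by positivity
    filter_upwards [hTz.eventually (gt_mem_nhds hK)] with n hn
    have hm0 : (0 : ℝ) < m n := by exact_mod_cast hm n
    rw [Real.rpow_lt_rpow_iff_of_neg hm0 (by positivity) (by linarith)] at hn
    have : (K : ℝ) ≤ m n := by linarith
    exact_mod_cast this
  have hmR : Tendsto (fun n : ℕ => (m n : ℝ)) atTop atTop := hn.comp hmN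
  -- normalised factors
  set A : ℕ → ℕ → ℝ := fun i n => (1 + ((i + n : ℕ) : ℝ)) ^ (-β₁) / (m n : ℝ) ^ (-β₂) with hA
  set B : ℕ → ℕ → ℝ := fun j n => (1 + ((j + m n : ℕ) : ℝ)) ^ (-β₂) / (m n : ℝ) ^ (-β₂) with hB
  have hAeq : ∀ i n, 0 < n → A i n =
      (((1 + i : ℝ) + n) / n) ^ (-β₁) * ((m n : ℝ) ^ (-β₂) / (n : ℝ) ^ (-β₁))⁻¹ := by
    intro i n hn0
    have hn1 : (0 : ℝ) < n := by exact_mod_cast hn0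
    have h2 : 0 < (n : ℝ) ^ (-β₁) := Real.rpow_pos_of_pos hn1 _
    have h3 := hT0 n
    rw [Real.div_rpow (by positivity) hn1.le]
    simp only [hA]
    push_cast
    rw [← add_assoc]
    field_simp
  have hBeq : ∀ j n, B j n = (((1 + j : ℝ) + m n) / m n) ^ (-β₂) := by
    intro j n
    rw [Real.div_rpow (by positivity) (by positivity)]
    simp only [hB]
    push_cast
    rw [← add_assoc]
  have hAlim : ∀ i, Tendsto (A i) atTop (nhds C⁻¹) := by
    intro i
    have h := (ratio_tendsto β₁ (1 + i) hn).mul (hratio.inv₀ hC.ne')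
    rw [one_mul] at h
    refine h.congr' ?_
    filter_upwards [eventually_gt_atTop 0] with n hn0
    exact (hAeq i n hn0).symm
  have hBlim : ∀ j, Tendsto (B j) atTop (nhds 1) := by
    intro j
    exact (ratio_tendsto β₂ (1 + j) hmR).congr fun n => (hBeq j n).symm
  have hone : ∀ (β a u : ℝ), 0 < β → 0 ≤ a → 0 < u → ((a + u) / u) ^ (-β) ≤ 1 := by
    intro β a u hβ ha hu
    refine Real.rpow_le_one_of_one_le_of_nonpos ?_ (by linarith)
    rw [le_div_iff₀ hu]; linarith
  have hA0 : ∀ i n, 0 ≤ A i n := fun i n => by simp only [hA]; positivity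
  have hB0 : ∀ i n, 0 ≤ B i n := fun i n => by simp only [hB]; positivity
  have hBle : ∀ j n, B j n ≤ 1 := fun j n => by
    rw [hBeq]
    exact hone _ _ _ hβ₂0 (by positivity) (by exact_mod_cast hm n)
  have hAle : ∀ᶠ n in atTop, ∀ i, A i n ≤ 2 / C := by
    filter_upwards [eventually_gt_atTop 0, hratio.eventually (lt_mem_nhds (half_lt_self hC))]
      with n hn0 hr i
    rw [hAeq i n hn0]
    have h1 := hone β₁ (1 + i) n hβ₁0 (by positivity) (by exact_mod_cast hn0)
    have h2 : ((m n : ℝ) ^ (-β₂) / (n : ℝ) ^ (-β₁))⁻¹ ≤ 2 / C := by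
      rw [← inv_div C 2]
      exact inv_anti₀ (by positivity) hr.le
    calc _ ≤ 1 * (2 / C) := by
          refine mul_le_mul h1 h2 ?_ zero_le_one
          exact inv_nonneg.mpr ((half_pos hC).trans hr).le
      _ = _ := one_mul _
  -- the normalised summand
  set X : ℕ → ℕ × ℕ → ℝ := fun n q => w (q.1 + n) q.2 * A q.1 n * (1 + (q.2 : ℝ)) ^ (-β₂) with hX
  set Y : ℕ → ℕ × ℕ → ℝ := fun n q => w q.1 (q.2 + m n) * B q.2 n * (1 + (q.1 : ℝ)) ^ (-β₁) with hY
  set F : ℕ → ℕ × ℕ → ℝ := fun n q => V α (X n q) (Y n q) with hF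
  set G : ℕ × ℕ → ℝ := fun q =>
    V α (wco q.2 * C⁻¹ * (1 + (q.2 : ℝ)) ^ (-β₂)) (winf q.1 * (1 + (q.1 : ℝ)) ^ (-β₁)) with hG
  have hFG : ∀ q, Tendsto (fun n => F n q) atTop (nhds (G q)) := by
    rintro ⟨i, j⟩
    refine V_tendsto _ _ _ ?_ ?_ ?_
    · have := (hA3 j).2
      positivity
    · have h : Tendsto (fun n => w (i + n) j) atTop (nhds (wco j)) :=
        (hA3 j).1.comp (tendsto_atTop_mono (fun n => Nat.le_add_left n i) tendsto_id)
      exact (h.mul (hAlim i)).mul_const _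
    · have h : Tendsto (fun n => w i (j + m n)) atTop (nhds (winf i)) :=
        (hA2 i).1.comp (tendsto_atTop_mono (fun n => Nat.le_add_left (m n) j) hmN)
      simpa using (h.mul (hBlim j)).mul_const ((1 + (i : ℝ)) ^ (-β₁))
  set bd : ℕ × ℕ → ℝ := fun q => ((W * (2 / C)) ^ s * W ^ (α - s)) *
    ((1 + (q.1 : ℝ)) ^ (-(β₁ * (α - s))) * (1 + (q.2 : ℝ)) ^ (-(β₂ * s))) with hbd
  have hbds : Summable bd := by
    refine Summable.mul_left _ ?_
    exact (summable_shift _ hp2).mul_of_nonneg (summable_shift _ hp1)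
      (fun i => by positivity) (fun i => by positivity)
  have hFb : ∀ᶠ n in atTop, ∀ q, ‖F n q‖ ≤ bd q := by
    filter_upwards [hAle] with n hAn
    rintro ⟨i, j⟩
    refine (V_bound α s _ _ hsα hs2.le).trans ?_
    have hx : |X n (i, j)| ≤ (W * (2 / C)) * (1 + (j : ℝ)) ^ (-β₂) := by
      simp only [hX, abs_mul, abs_of_nonneg (hA0 i n)]
      rw [abs_of_nonneg (by positivity : 0 ≤ (1 + (j : ℝ)) ^ (-β₂))]
      gcongr
      · exact hW _ _
      · exact hAn i
    have hy : |Y n (i, j)| ≤ W * (1 + (i : ℝ)) ^ (-β₁) := by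
      simp only [hY, abs_mul, abs_of_nonneg (hB0 j n)]
      rw [abs_of_nonneg (by positivity : 0 ≤ (1 + (i : ℝ)) ^ (-β₁))]
      gcongr
      calc _ ≤ W * 1 := mul_le_mul (hW _ _) (hBle j n) (hB0 j n) hW0.le
        _ = W := mul_one _
    calc _ ≤ ((W * (2 / C)) * (1 + (j : ℝ)) ^ (-β₂)) ^ s *
          (W * (1 + (i : ℝ)) ^ (-β₁)) ^ (α - s) := by
          gcongr
      _ = bd (i, j) := by
          rw [Real.mul_rpow (x := W * (2 / C)) (by positivity) (by positivity),
            Real.mul_rpow (x := W) (y := (1 + (i : ℝ)) ^ (-β₁)) (by positivity) (by positivity),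
            ← Real.rpow_mul (by positivity), ← Real.rpow_mul (by positivity)]
          simp only [hbd, neg_mul]
          ring
  have hGb : ∀ q, ‖G q‖ ≤ bd q := fun q =>
    le_of_tendsto (hFG q).norm (hFb.mono fun n h => h q)
  have hGs : Summable G := Summable.of_norm_bounded hbds hGb
  have hmain := tendsto_tsum_of_dominated_convergence hbds hFG hFb
  have hfin := hratio.mul hmain
  have hGeq : ∑' i : ℕ, ∑' j : ℕ,
        V α (wco j * C⁻¹ * (1 + (j : ℝ)) ^ (-β₂)) (winf i * (1 + (i : ℝ)) ^ (-β₁)) = ∑' q, G q :=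
    hGs.tsum_prod.symm
  rw [hGeq]
  refine hfin.congr' ?_
  filter_upwards [eventually_gt_atTop 0] with n hn0
  have hn1 : (0 : ℝ) < n := by exact_mod_cast hn0
  have hm1 : (0 : ℝ) < m n := by exact_mod_cast hm n
  have hT := hT0 n
  rw [hρ n (m n) hn0 (hm n), ← (hsum n (m n) hn0 (hm n)).tsum_prod]
  have hFe : ∀ q, F n q = V α (c (q.1 + n) q.2) (c q.1 (q.2 + m n)) / ((m n : ℝ) ^ (-β₂)) ^ α := by
    rintro ⟨i, j⟩
    rw [← V_hom _ _ _ _ hT]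
    simp only [hF, hX, hY, hA, hB, hc]
    congr 1 <;> ring
  simp_rw [hFe]
  rw [tsum_div_const]
  have e1 : (m n : ℝ) ^ (-(β₂ * (α - 1))) = ((m n : ℝ) ^ (-β₂)) ^ α / (m n : ℝ) ^ (-β₂) := by
    rw [← Real.rpow_mul hm1.le, ← Real.rpow_sub hm1]
    congr 1; ring
  have h2 : 0 < (n : ℝ) ^ (-β₁) := Real.rpow_pos_of_pos hn1 _
  have h3 : 0 < ((m n : ℝ) ^ (-β₂)) ^ α := Real.rpow_pos_of_pos hT _
  rw [e1]
  field_simp
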